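/- arXiv:2508.00644 — 2 statements merged into one kernel-verified Lean document; each statement's English description precedes it below -/
import Mathlib

section
/- For any input bigrading (h,q), the bigraded type D structure Cb_D(•) is homotopy equivalent to the three-generator chain •(h−2, q−4) →S_• ∘(h−1, q−3) →D_∘ ∘(h, q−1). -/
/-- Generators of the Bar-Natan algebra: the two vertex idempotents and the four arrows. -/
inductive BNGen : Type
  | eb | ec | db | dc | sb | sc
  deriving DecidableEq

/-- The relations presenting the Bar-Natan algebra as a quotient of the free algebra on
the vertex idempotents and arrows of the quiver: the path-algebra relations for the
two-vertex quiver, together with the four relations `D∘S• = S•D• = D•S∘ = S∘D∘ = 0`. -/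
inductive BNRel (R : Type*) [CommRing R] :
    FreeAlgebra R BNGen → FreeAlgebra R BNGen → Prop
  | idem_b : BNRel R (FreeAlgebra.ι R BNGen.eb * FreeAlgebra.ι R BNGen.eb) (FreeAlgebra.ι R BNGen.eb)
  | idem_c : BNRel R (FreeAlgebra.ι R BNGen.ec * FreeAlgebra.ι R BNGen.ec) (FreeAlgebra.ι R BNGen.ec)
  | orth_bc : BNRel R (FreeAlgebra.ι R BNGen.eb * FreeAlgebra.ι R BNGen.ec) 0
  | orth_cb : BNRel R (FreeAlgebra.ι R BNGen.ec * FreeAlgebra.ι R BNGen.eb) 0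
  | sum_idem : BNRel R (FreeAlgebra.ι R BNGen.eb + FreeAlgebra.ι R BNGen.ec) 1
  | typ_sb : BNRel R (FreeAlgebra.ι R BNGen.ec * FreeAlgebra.ι R BNGen.sb * FreeAlgebra.ι R BNGen.eb) (FreeAlgebra.ι R BNGen.sb)
  | typ_sc : BNRel R (FreeAlgebra.ι R BNGen.eb * FreeAlgebra.ι R BNGen.sc * FreeAlgebra.ι R BNGen.ec) (FreeAlgebra.ι R BNGen.sc)
  | typ_db : BNRel R (FreeAlgebra.ι R BNGen.eb * FreeAlgebra.ι R BNGen.db * FreeAlgebra.ι R BNGen.eb) (FreeAlgebra.ι R BNGen.db)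
  | typ_dc : BNRel R (FreeAlgebra.ι R BNGen.ec * FreeAlgebra.ι R BNGen.dc * FreeAlgebra.ι R BNGen.ec) (FreeAlgebra.ι R BNGen.dc)
  | rel_DcSb : BNRel R (FreeAlgebra.ι R BNGen.dc * FreeAlgebra.ι R BNGen.sb) 0
  | rel_SbDb : BNRel R (FreeAlgebra.ι R BNGen.sb * FreeAlgebra.ι R BNGen.db) 0
  | rel_DbSc : BNRel R (FreeAlgebra.ι R BNGen.db * FreeAlgebra.ι R BNGen.sc) 0
  | rel_ScDc : BNRel R (FreeAlgebra.ι R BNGen.sc * FreeAlgebra.ι R BNGen.dc) 0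

/-- The Bar-Natan algebra `B` over `R`. -/
abbrev BN (R : Type*) [CommRing R] : Type _ := RingQuot (BNRel R)

noncomputable section

/-- The image in `B` of a generator. -/
def BNgen (R : Type*) [CommRing R] (g : BNGen) : BN R :=
  RingQuot.mkAlgHom R (BNRel R) (FreeAlgebra.ι R g)

def eB (R : Type*) [CommRing R] : BN R := BNgen R BNGen.eb
def eC (R : Type*) [CommRing R] : BN R := BNgen R BNGen.ec
def Db (R : Type*) [CommRing R] : BN R := BNgen R BNGen.db
def Dc (R : Type*) [CommRing R] : BN R := BNgen R BNGen.dc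
def Sb (R : Type*) [CommRing R] : BN R := BNgen R BNGen.sb
def Sc (R : Type*) [CommRing R] : BN R := BNgen R BNGen.sc

/-- `SS_• = S_∘ S_•`. -/
def SSb (R : Type*) [CommRing R] : BN R := Sc R * Sb R
/-- `SS_∘ = S_• S_∘`. -/
def SSc (R : Type*) [CommRing R] : BN R := Sb R * Sc R
/-- `G_• = SS_• − D_•`. -/
def Gb (R : Type*) [CommRing R] : BN R := SSb R - Db R
/-- `G_∘ = SS_∘ − D_∘`. -/
def Gc (R : Type*) [CommRing R] : BN R := SSc R - Dc R

/-- The quantum weight of a generator: `0` for idempotents, `−1` for `S`'s, `−2` for `D`'s. -/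
def wt : BNGen → ℤ
  | .eb => 0 | .ec => 0 | .sb => -1 | .sc => -1 | .db => -2 | .dc => -2

/-- `Homog R d x` says that `x ∈ B` is quantum-homogeneous of degree `d`: it lies in the
`R`-span of the products of generators whose total weight is `d`. -/
def Homog (R : Type*) [CommRing R] (d : ℤ) (x : BN R) : Prop :=
  x ∈ Submodule.span R
    {y : BN R | ∃ l : List BNGen, (l.map wt).sum = d ∧ y = (l.map (BNgen R)).prod}

/-- Raw data of a bigraded type D structure over the Bar-Natan algebra: a finite set of
generators labelled `•` (`true`) or `∘` (`false`), each with a bigrading `(h, q)`, and a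
matrix of differential coefficients in `B`. -/
structure PreTypeD (R : Type*) [CommRing R] where
  V : Type
  [fin : Fintype V]
  [dec : DecidableEq V]
  lbl : V → Bool
  gr : V → ℤ × ℤ
  δ : V → V → BN R

attribute [instance] PreTypeD.fin PreTypeD.dec

/-- The idempotent of `B` corresponding to a vertex label. -/
def idem (R : Type*) [CommRing R] (b : Bool) : BN R := if b then eB R else eC R

/-- The identity matrix of a type D structure. -/
def idmat (R : Type*) [CommRing R] (X : PreTypeD R) : X.V → X.V → BN R :=
  fun x y => if x = y then idem R (X.lbl x) else 0

/-- A matrix `f` (from `X` to `Y`) respects the idempotents. -/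
def IsHom (R : Type*) [CommRing R] (X Y : PreTypeD R) (f : X.V → Y.V → BN R) : Prop :=
  ∀ x y, idem R (Y.lbl y) * f x y * idem R (X.lbl x) = f x y

/-- A matrix `f` (from `X` to `Y`) is bigraded of bidegree `(dh, 0)`: whenever
`f x y ≠ 0`, the homological gradings satisfy `h(y) = h(x) + dh`, and each entry `f x y`
is quantum-homogeneous of degree `q(x) − q(y)`. -/
def IsGraded (R : Type*) [CommRing R] (X Y : PreTypeD R) (dh : ℤ)
    (f : X.V → Y.V → BN R) : Prop :=
  (∀ x y, f x y ≠ 0 → (Y.gr y).1 = (X.gr x).1 + dh) ∧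
  (∀ x y, Homog R ((X.gr x).2 - (Y.gr y).2) (f x y))

/-- A chain map of type D structures. -/
def IsDChain (R : Type*) [CommRing R] (X Y : PreTypeD R) (f : X.V → Y.V → BN R) : Prop :=
  IsHom R X Y f ∧ ∀ x z, (∑ y, f y z * X.δ x y) = (∑ y, Y.δ y z * f x y)

/-- Matrix composite of `f : X → Y` and `g : Y → Z`. -/
def compMat (R : Type*) [CommRing R] (X Y Z : PreTypeD R)
    (f : X.V → Y.V → BN R) (g : Y.V → Z.V → BN R) : X.V → Z.V → BN R :=
  fun x z => ∑ y, g y z * f x y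

/-- `F` is a homotopy from the endo-matrix `φ` of `X` to the identity:
`φ − id = δF + Fδ`. -/
def HtpyToId (R : Type*) [CommRing R] (X : PreTypeD R)
    (φ F : X.V → X.V → BN R) : Prop :=
  ∀ x z, φ x z - idmat R X x z = (∑ y, X.δ y z * F x y) + (∑ y, F y z * X.δ x y)

/-- Bigraded chain homotopy equivalence of type D structures over `B`. -/
def HEquiv (R : Type*) [CommRing R] (X Y : PreTypeD R) : Prop :=
  ∃ (f : X.V → Y.V → BN R) (g : Y.V → X.V → BN R)
    (F : X.V → X.V → BN R) (G : Y.V → Y.V → BN R),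
    IsDChain R X Y f ∧ IsDChain R Y X g ∧
    IsGraded R X Y 0 f ∧ IsGraded R Y X 0 g ∧
    IsHom R X X F ∧ IsHom R Y Y G ∧
    IsGraded R X X (-1) F ∧ IsGraded R Y Y (-1) G ∧
    HtpyToId R X (compMat R X Y X f g) F ∧ HtpyToId R Y (compMat R Y X Y g f) G

/-- Chain homotopy equivalence of type D structures over `B`, after forgetting bigradings. -/
def HEquivU (R : Type*) [CommRing R] (X Y : PreTypeD R) : Prop :=
  ∃ (f : X.V → Y.V → BN R) (g : Y.V → X.V → BN R)
    (F : X.V → X.V → BN R) (G : Y.V → Y.V → BN R),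
    IsDChain R X Y f ∧ IsDChain R Y X g ∧
    IsHom R X X F ∧ IsHom R Y Y G ∧
    HtpyToId R X (compMat R X Y X f g) F ∧ HtpyToId R Y (compMat R Y X Y g f) G

/-- Direct sum of two type D structures. -/
def psum (R : Type*) [CommRing R] (X Y : PreTypeD R) : PreTypeD R where
  V := X.V ⊕ Y.V
  lbl := Sum.elim X.lbl Y.lbl
  gr := Sum.elim X.gr Y.gr
  δ := fun p q =>
    match p, q with
    | .inl a, .inl b => X.δ a b
    | .inr a, .inr b => Y.δ a b
    | _, _ => 0

/-- The zero type D structure. -/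
def zeroPre (R : Type*) [CommRing R] : PreTypeD R where
  V := Empty
  lbl := fun e => e.elim
  gr := fun e => e.elim
  δ := fun e => e.elim

/-- Finite direct sums of type D structures. -/
def bigSum (R : Type*) [CommRing R] : (m : ℕ) → (Fin m → PreTypeD R) → PreTypeD R
  | 0, _ => zeroPre R
  | m + 1, F => psum R (F 0) (bigSum R m fun i => F i.succ)

/-- Formal edge labels for labelled graphs: `0`, or a scalar multiple of one of
`S_•`, `S_∘`, `D_∘`, `SS_∘`, `D_•^k`. -/
inductive Lab (R : Type*) : Type _
  | nul : Lab R
  | sB (c : R) : Lab R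
  | sC (c : R) : Lab R
  | dC (c : R) : Lab R
  | ssC (c : R) : Lab R
  | dBpow (c : R) (k : ℕ) : Lab R

/-- Evaluation of a formal edge label in `B`. -/
def evLab (R : Type*) [CommRing R] : Lab R → BN R
  | .nul => 0
  | .sB c => c • Sb R
  | .sC c => c • Sc R
  | .dC c => c • Dc R
  | .ssC c => c • SSc R
  | .dBpow c k => c • (Db R ^ k)

/-- A labelled-graph presentation of a bigraded type D structure: vertices `Fin n`
labelled `•` (`true`) or `∘` (`false`), bigradings, and formal edge labels. -/
structure LG (R : Type*) where
  n : ℕ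
  lbl : Fin n → Bool
  gr : Fin n → ℤ × ℤ
  lab : Fin n → Fin n → Lab R

/-- The type D structure data underlying a labelled graph. -/
def LGtoPre (R : Type*) [CommRing R] (X : LG R) : PreTypeD R where
  V := Fin X.n
  lbl := X.lbl
  gr := X.gr
  δ := fun i j => evLab R (X.lab i j)

/-- Compatibility of an edge label with the labels of its source and target vertices,
including nonvanishing of the scalar and `k ≥ 1` for powers of `D_•`. -/
def okLab (R : Type*) [CommRing R] : Lab R → Bool → Bool → Prop
  | .nul, _, _ => True
  | .sB c, b1, b2 => c ≠ 0 ∧ b1 = true ∧ b2 = false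
  | .sC c, b1, b2 => c ≠ 0 ∧ b1 = false ∧ b2 = true
  | .dC c, b1, b2 => c ≠ 0 ∧ b1 = false ∧ b2 = false
  | .ssC c, b1, b2 => c ≠ 0 ∧ b1 = false ∧ b2 = false
  | .dBpow c k, b1, b2 => c ≠ 0 ∧ 1 ≤ k ∧ b1 = true ∧ b2 = true

/-- A labelled graph is a bigraded type D structure: the labels are compatible with the
vertex labels (each being a nonzero scalar multiple of `S_•`, `S_∘`, `D_∘`, `SS_∘` or
`D_•^k`, `k ≥ 1`), `d² = 0`, and the bigradings are compatible with the edges. -/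
def IsTypeD (R : Type*) [CommRing R] (X : LG R) : Prop :=
  (∀ i j, okLab R (X.lab i j) (X.lbl i) (X.lbl j)) ∧
  (∀ i k, (∑ j, evLab R (X.lab j k) * evLab R (X.lab i j)) = 0) ∧
  (∀ i j, X.lab i j ≠ Lab.nul → (X.gr j).1 = (X.gr i).1 + 1) ∧
  (∀ i j, Homog R ((X.gr i).2 - (X.gr j).2) (evLab R (X.lab i j)))

/-- The number of generators in the grid `Cb_D(•)` (`13`) resp. `Cb_D(∘)` (`12`). -/
def gridV : Bool → ℕ
  | true => 13
  | false => 12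

/-- Vertex labels of the grid `Cb_D(•)`: generators
`a₁ = 0, a₂ = 1, B = 2, C = 3, E = 4, F = 5, W = 6, p₁ = 7, p₂ = 8, q₁ = 9, q₂ = 10,
u₁ = 11, u₂ = 12`. -/
def bullLbl : Fin 13 → Bool := fun i =>
  match i.val with
  | 4 | 5 | 7 | 8 | 9 | 10 => false
  | _ => true

/-- Vertex labels of the grid `Cb_D(∘)`: generators
`M = 0, T₁ = 1, T₂ = 2, v₁₁ = 3, v₁₂ = 4, v₂₁ = 5, v₂₂ = 6, v₃₁ = 7, v₃₂ = 8,
b₁ = 9, b₂ = 10, b₃ = 11`. -/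
def circLbl : Fin 12 → Bool := fun i =>
  match i.val with
  | 0 | 7 | 8 | 11 => true
  | _ => false

/-- Bigradings of the generators of `Cb_D(•)` with input bigrading `(h, q)`. -/
def bullGr (h q : ℤ) : Fin 13 → ℤ × ℤ := fun i =>
  match i.val with
  | 0 => (h - 2, q - 4)
  | 1 => (h - 2, q - 2)
  | 2 => (h - 1, q - 2)
  | 3 => (h, q)
  | 4 => (h, q - 1)
  | 5 => (h + 1, q + 1)
  | 6 => (h + 2, q + 2)
  | 7 => (h - 1, q - 3)
  | 8 => (h - 1, q - 1)
  | 9 => (h, q - 1)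
  | 10 => (h, q + 1)
  | 11 => (h + 1, q)
  | _ => (h + 1, q + 2)

/-- Bigradings of the generators of `Cb_D(∘)` with input bigrading `(h, q)`. -/
def circGr (h q : ℤ) : Fin 12 → ℤ × ℤ := fun i =>
  match i.val with
  | 0 => (h - 2, q - 3)
  | 1 => (h - 1, q - 2)
  | 2 => (h, q)
  | 3 => (h, q - 2)
  | 4 => (h, q)
  | 5 => (h + 1, q)
  | 6 => (h + 1, q + 2)
  | 7 => (h + 2, q + 1)
  | 8 => (h + 2, q + 3)
  | 9 => (h - 1, q - 2)
  | 10 => (h, q)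
  | _ => (h + 1, q + 1)

/-- The differential of `Cb_D(•)`. -/
def bullδ (R : Type*) [CommRing R] : Fin 13 → Fin 13 → BN R := fun i j =>
  match i.val, j.val with
  | 0, 7 => Sb R
  | 1, 2 => eB R
  | 1, 8 => Sb R
  | 2, 4 => -Sb R
  | 3, 5 => Sb R
  | 3, 11 => -eB R
  | 3, 12 => -Gb R
  | 4, 5 => Dc R
  | 5, 6 => Sc R
  | 7, 9 => Dc R
  | 8, 4 => eC R
  | 8, 10 => Dc R
  | 9, 11 => Sc R
  | 10, 5 => -eC R
  | 10, 12 => Sc R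
  | 11, 6 => Db R
  | 12, 6 => eB R
  | _, _ => 0

/-- The differential of `Cb_D(∘)`. -/
def circδ (R : Type*) [CommRing R] : Fin 12 → Fin 12 → BN R := fun i j =>
  match i.val, j.val with
  | 0, 1 => Sb R
  | 0, 9 => Sb R
  | 1, 2 => Dc R
  | 1, 3 => -eC R
  | 1, 4 => -SSc R
  | 2, 5 => eC R
  | 2, 6 => SSc R
  | 2, 11 => -Sc R
  | 3, 5 => Dc R
  | 4, 6 => Dc R
  | 5, 7 => Sc R
  | 6, 8 => Sc R
  | 9, 3 => eC R
  | 9, 4 => Gc R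
  | 9, 10 => Dc R
  | 10, 5 => -eC R
  | 10, 6 => -Gc R
  | 10, 11 => Sc R
  | 11, 7 => eB R
  | 11, 8 => SSb R
  | _, _ => 0

/-- Vertex labels of the grid `Cb_D(•)` resp. `Cb_D(∘)`. -/
def gridLbl : (b : Bool) → Fin (gridV b) → Bool
  | true => bullLbl
  | false => circLbl

/-- Bigradings of the grid `Cb_D(•)` resp. `Cb_D(∘)`. -/
def gridGr : (b : Bool) → ℤ × ℤ → Fin (gridV b) → ℤ × ℤ
  | true => fun p => bullGr p.1 p.2
  | false => fun p => circGr p.1 p.2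

/-- Internal differential of the grid `Cb_D(•)` resp. `Cb_D(∘)`. -/
def gridδ (R : Type*) [CommRing R] : (b : Bool) → Fin (gridV b) → Fin (gridV b) → BN R
  | true => bullδ R
  | false => circδ R

/-- `Cb_D(•)` as a bigraded type D structure, with input bigrading `(h, q)`. -/
def CbBull (R : Type*) [CommRing R] (h q : ℤ) : PreTypeD R where
  V := Fin 13
  lbl := bullLbl
  gr := bullGr h q
  δ := bullδ R

/-- `Cb_D(∘)` as a bigraded type D structure, with input bigrading `(h, q)`. -/
def CbCirc (R : Type*) [CommRing R] (h q : ℤ) : PreTypeD R where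
  V := Fin 12
  lbl := circLbl
  gr := circGr h q
  δ := circδ R

/-- The matrix `Cb_D(S_•)`, from the grid of `Cb_D(•)` to the grid of `Cb_D(∘)`. -/
def matSb (R : Type*) [CommRing R] : Fin 13 → Fin 12 → BN R := fun i j =>
  match i.val, j.val with
  | 0, 0 => Db R
  | 1, 0 => eB R
  | 2, 1 => -Sb R
  | 3, 2 => Sb R
  | 4, 3 => eC R
  | 4, 4 => Gc R
  | 5, 5 => -eC R
  | 5, 6 => -Gc R
  | 6, 7 => eB R
  | 6, 8 => SSb R
  | 8, 9 => -eC R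
  | 10, 10 => eC R
  | 11, 11 => -Db R
  | 12, 11 => -eB R
  | _, _ => 0

/-- The matrix `Cb_D(S_∘)`, from the grid of `Cb_D(∘)` to the grid of `Cb_D(•)`. -/
def matSc (R : Type*) [CommRing R] : Fin 12 → Fin 13 → BN R := fun i j =>
  match i.val, j.val with
  | 0, 0 => eB R
  | 0, 1 => SSb R
  | 1, 2 => -Sc R
  | 2, 3 => Sc R
  | 4, 4 => eC R
  | 6, 5 => -eC R
  | 7, 6 => Db R
  | 8, 6 => eB R
  | 9, 7 => -eC R
  | 9, 8 => -Gc R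
  | 10, 9 => eC R
  | 10, 10 => Gc R
  | 11, 11 => -eB R
  | 11, 12 => -SSb R
  | _, _ => 0

/-- The matrix `Cb_D(D_∘)`, from the grid of `Cb_D(∘)` to itself. -/
def matDc (R : Type*) [CommRing R] : Fin 12 → Fin 12 → BN R := fun i j =>
  match i.val, j.val with
  | 1, 1 => -Dc R
  | 2, 2 => Dc R
  | 3, 3 => -Gc R
  | 4, 3 => eC R
  | 5, 5 => Gc R
  | 6, 5 => -eC R
  | 7, 7 => -(SSb R + Db R)
  | 8, 7 => eB R
  | _, _ => 0

/-- The matrix `Cb_D(SS_∘)`, from the grid of `Cb_D(∘)` to itself. -/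
def matSSc (R : Type*) [CommRing R] : Fin 12 → Fin 12 → BN R := fun i j =>
  match i.val, j.val with
  | 0, 0 => SSb R + Db R
  | 1, 1 => -SSc R
  | 2, 2 => SSc R
  | 4, 3 => eC R
  | 4, 4 => Gc R
  | 6, 5 => -eC R
  | 6, 6 => -Gc R
  | 7, 7 => Db R
  | 8, 7 => eB R
  | 8, 8 => SSb R
  | 9, 9 => -Gc R
  | 10, 10 => Gc R
  | 11, 11 => -(SSb R + Db R)
  | _, _ => 0

/-- The matrix `Cb_D(D_•^k)`, from the grid of `Cb_D(•)` to itself. -/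
def matDbk (R : Type*) [CommRing R] (k : ℕ) : Fin 13 → Fin 13 → BN R := fun i j =>
  match i.val, j.val with
  | 0, 0 => Gb R ^ (k - 1) * SSb R
  | 1, 0 => if k % 2 = 0 then -(Gb R ^ (k - 2) * (SSb R + Db R)) else -(Gb R ^ (k - 1))
  | 1, 1 => if k % 2 = 0 then -(Gb R ^ (k - 1) * Db R) else Gb R ^ (k - 1) * Db R
  | 2, 2 => -(Db R ^ k)
  | 3, 3 => Db R ^ k
  | 7, 7 => -(Gb R ^ k)
  | 8, 7 => Gb R ^ (k - 1)
  | 9, 9 => Gb R ^ k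
  | 10, 9 => -(Gb R ^ (k - 1))
  | 11, 11 => -(Gb R ^ (k - 1) * SSb R)
  | 12, 11 => if k % 2 = 0 then Gb R ^ (k - 2) * (SSb R + Db R) else Gb R ^ (k - 1)
  | 12, 12 => if k % 2 = 0 then Gb R ^ (k - 1) * Db R else -(Gb R ^ (k - 1) * Db R)
  | _, _ => 0

/-- The matrix of maps between grids induced by a formal edge label. -/
def edgeMat (R : Type*) [CommRing R] :
    Lab R → (b1 : Bool) → (b2 : Bool) → Fin (gridV b1) → Fin (gridV b2) → BN R
  | .sB c, true, false => fun i j => c • matSb R i j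
  | .sC c, false, true => fun i j => c • matSc R i j
  | .dC c, false, false => fun i j => c • matDc R i j
  | .ssC c, false, false => fun i j => c • matSSc R i j
  | .dBpow c k, true, true => fun i j => c • matDbk R k i j
  | _, _, _ => fun _ _ => 0

/-- The cabling operator `Cb_D` applied to a labelled graph: one grid (`Cb_D(•)` or
`Cb_D(∘)`) per generator, with the internal differentials of each grid, together with
the matrices induced by each edge label. -/
def CbD (R : Type*) [CommRing R] (X : LG R) : PreTypeD R where
  V := Σ x : Fin X.n, Fin (gridV (X.lbl x))
  lbl := fun p => gridLbl (X.lbl p.1) p.2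
  gr := fun p => gridGr (X.lbl p.1) (X.gr p.1) p.2
  δ := fun p q =>
    (if h : p.1 = q.1 then gridδ R (X.lbl p.1) p.2 (Fin.cast (by rw [h]) q.2) else 0)
    + edgeMat R (X.lab p.1 q.1) (X.lbl p.1) (X.lbl q.1) p.2 q.2

/-! ### The multiplication table of the Bar-Natan algebra -/

section Relations

variable (R : Type*) [CommRing R]

lemma BN_mk_eq {x y : FreeAlgebra R BNGen} (hxy : BNRel R x y) :
    RingQuot.mkAlgHom R (BNRel R) x = RingQuot.mkAlgHom R (BNRel R) y :=
  RingQuot.mkAlgHom_rel R hxy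

/-- `neg_mul` for the `Neg` instance of `BN R`, which `simp` does not unify with the generic one. -/
lemma BN_neg_mul (x y : BN R) : -x * y = -(x * y) := neg_mul x y

/-- `mul_neg` for the `Neg` instance of `BN R`, which `simp` does not unify with the generic one. -/
lemma BN_mul_neg (x y : BN R) : x * -y = -(x * y) := mul_neg x y

lemma eB_mul_eB : eB R * eB R = eB R := by
  simpa [eB, BNgen] using BN_mk_eq R .idem_b

lemma eC_mul_eC : eC R * eC R = eC R := by
  simpa [eC, BNgen] using BN_mk_eq R .idem_c

lemma eC_mul_Sb_mul_eB : eC R * Sb R * eB R = Sb R := by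
  simpa [eB, eC, Sb, BNgen] using BN_mk_eq R .typ_sb

lemma eB_mul_Sc_mul_eC : eB R * Sc R * eC R = Sc R := by
  simpa [eB, eC, Sc, BNgen] using BN_mk_eq R .typ_sc

lemma eB_mul_Db_mul_eB : eB R * Db R * eB R = Db R := by
  simpa [eB, Db, BNgen] using BN_mk_eq R .typ_db

lemma eC_mul_Dc_mul_eC : eC R * Dc R * eC R = Dc R := by
  simpa [eC, Dc, BNgen] using BN_mk_eq R .typ_dc

lemma Db_mul_Sc : Db R * Sc R = 0 := by
  simpa [Db, Sc, BNgen] using BN_mk_eq R .rel_DbSc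

lemma Sc_mul_Dc : Sc R * Dc R = 0 := by
  simpa [Sc, Dc, BNgen] using BN_mk_eq R .rel_ScDc

lemma eC_mul_Sb : eC R * Sb R = Sb R := by
  rw [← eC_mul_Sb_mul_eB, ← mul_assoc, ← mul_assoc, eC_mul_eC]

lemma Sb_mul_eB : Sb R * eB R = Sb R := by
  rw [← eC_mul_Sb_mul_eB, mul_assoc, eB_mul_eB]

lemma eB_mul_Sc : eB R * Sc R = Sc R := by
  rw [← eB_mul_Sc_mul_eC, ← mul_assoc, ← mul_assoc, eB_mul_eB]

lemma Sc_mul_eC : Sc R * eC R = Sc R := by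
  rw [← eB_mul_Sc_mul_eC, mul_assoc, eC_mul_eC]

lemma eB_mul_Db : eB R * Db R = Db R := by
  rw [← eB_mul_Db_mul_eB, ← mul_assoc, ← mul_assoc, eB_mul_eB]

lemma Db_mul_eB : Db R * eB R = Db R := by
  rw [← eB_mul_Db_mul_eB, mul_assoc, eB_mul_eB]

lemma eC_mul_Dc : eC R * Dc R = Dc R := by
  rw [← eC_mul_Dc_mul_eC, ← mul_assoc, ← mul_assoc, eC_mul_eC]

lemma Dc_mul_eC : Dc R * eC R = Dc R := by
  rw [← eC_mul_Dc_mul_eC, mul_assoc, eC_mul_eC]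

lemma Sb_mul_Sc : Sb R * Sc R = SSc R := rfl

lemma eC_mul_SSc : eC R * SSc R = SSc R := by
  rw [SSc, ← mul_assoc, eC_mul_Sb]

lemma SSc_mul_eC : SSc R * eC R = SSc R := by
  rw [SSc, mul_assoc, Sc_mul_eC]

lemma SSc_mul_Dc : SSc R * Dc R = 0 := by
  rw [SSc, mul_assoc, Sc_mul_Dc, mul_zero]

lemma Gb_mul_eB : Gb R * eB R = Gb R := by
  rw [Gb, SSb, sub_mul, mul_assoc, Sb_mul_eB, Db_mul_eB]

lemma Gb_mul_Sc : Gb R * Sc R = Sc R * SSc R := by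
  rw [Gb, SSb, SSc, sub_mul, Db_mul_Sc, sub_zero, mul_assoc]

end Relations

/-! ### Quantum-homogeneous elements -/

section Homogeneous

variable {R : Type*} [CommRing R]

lemma Homog.zero (d : ℤ) : Homog R d 0 := Submodule.zero_mem _

lemma Homog.neg {d : ℤ} {x : BN R} (hx : Homog R d x) : Homog R d (-x) :=
  Submodule.neg_mem _ hx

lemma homog_list_prod (l : List BNGen) :
    Homog R (l.map wt).sum (l.map (BNgen R)).prod :=
  Submodule.subset_span ⟨l, rfl, rfl⟩

lemma homog_eB : Homog R 0 (eB R) := by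
  simpa [wt, eB] using homog_list_prod (R := R) [.eb]

lemma homog_eC : Homog R 0 (eC R) := by
  simpa [wt, eC] using homog_list_prod (R := R) [.ec]

lemma homog_Sb : Homog R (-1) (Sb R) := by
  simpa [wt, Sb] using homog_list_prod (R := R) [.sb]

lemma homog_Sc : Homog R (-1) (Sc R) := by
  simpa [wt, Sc] using homog_list_prod (R := R) [.sc]

lemma homog_SSc : Homog R (-2) (SSc R) := by
  simpa [wt, SSc, Sb, Sc] using homog_list_prod (R := R) [.sb, .sc]

end Homogeneous

lemma Fin.sum_univ_thirteen {M : Type*} [AddCommMonoid M] (f : Fin 13 → M) :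
    ∑ i, f i =
      f 0 + f 1 + f 2 + f 3 + f 4 + f 5 + f 6 + f 7 + f 8 + f 9 + f 10 + f 11 + f 12 := by
  simp [Fin.sum_univ_castSucc]

/-! ### The deformation retraction of `Cb_D(•)` onto its three-generator chain -/

section Retraction

variable (R : Type*) [CommRing R]

/-- The chain `•(h−2, q−4) →S_• ∘(h−1, q−3) →D_∘ ∘(h, q−1)`. -/
abbrev chainBull (h q : ℤ) : PreTypeD R where
  V := Fin 3
  lbl := ![true, false, false]
  gr := ![(h - 2, q - 4), (h - 1, q - 3), (h, q - 1)]
  δ := ![![0, Sb R, 0], ![0, 0, Dc R], ![0, 0, 0]]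

/-- The projection of `Cb_D(•)` onto the generators `a₁`, `p₁`, `q₁`. -/
def bullProj : Fin 13 → Fin 3 → BN R := fun i j =>
  match i.val, j.val with
  | 0, 0 => eB R
  | 7, 1 => eC R
  | 9, 2 => eC R
  | _, _ => 0

/-- The inclusion of the three-generator chain into `Cb_D(•)`, a section of `bullProj`. -/
def bullIncl : Fin 3 → Fin 13 → BN R := fun i j =>
  match i.val, j.val with
  | 0, 0 => eB R
  | 1, 7 => eC R
  | 2, 9 => eC R
  | 2, 3 => Sc R
  | 2, 10 => SSc R
  | _, _ => 0

/-- The homotopy from the retraction `bullIncl ∘ bullProj` to the identity of `Cb_D(•)`. -/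
def bullHtpy : Fin 13 → Fin 13 → BN R := fun i j =>
  match i.val, j.val with
  | 2, 1 => -eB R
  | 4, 8 => -eC R
  | 5, 10 => eC R
  | 6, 12 => -eB R
  | 11, 3 => eB R
  | 11, 10 => Sb R
  | _, _ => 0

/-! The rows of the matrices, paired with an arbitrary covector. -/

lemma sum_mul_bullδ (φ : Fin 13 → BN R) (x : Fin 13) :
    ∑ y, φ y * bullδ R x y =
      match x.val with
      | 0 => φ 7 * Sb R
      | 1 => φ 2 * eB R + φ 8 * Sb R
      | 2 => -(φ 4 * Sb R)
      | 3 => φ 5 * Sb R - φ 11 * eB R - φ 12 * Gb R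
      | 4 => φ 5 * Dc R
      | 5 => φ 6 * Sc R
      | 7 => φ 9 * Dc R
      | 8 => φ 4 * eC R + φ 10 * Dc R
      | 9 => φ 11 * Sc R
      | 10 => φ 12 * Sc R - φ 5 * eC R
      | 11 => φ 6 * Db R
      | 12 => φ 6 * eB R
      | _ => 0 := by
  fin_cases x <;> simp [Fin.sum_univ_thirteen, bullδ, BN_mul_neg] <;> abel

lemma sum_mul_bullProj (φ : Fin 3 → BN R) (x : Fin 13) :
    ∑ y, φ y * bullProj R x y =
      match x.val with
      | 0 => φ 0 * eB R
      | 7 => φ 1 * eC R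
      | 9 => φ 2 * eC R
      | _ => 0 := by
  fin_cases x <;> simp [Fin.sum_univ_three, bullProj]

lemma sum_mul_bullIncl (φ : Fin 13 → BN R) (x : Fin 3) :
    ∑ y, φ y * bullIncl R x y =
      match x.val with
      | 0 => φ 0 * eB R
      | 1 => φ 7 * eC R
      | 2 => φ 3 * Sc R + φ 9 * eC R + φ 10 * SSc R
      | _ => 0 := by
  fin_cases x <;> simp [Fin.sum_univ_thirteen, bullIncl]

lemma sum_mul_bullHtpy (φ : Fin 13 → BN R) (x : Fin 13) :
    ∑ y, φ y * bullHtpy R x y =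
      match x.val with
      | 2 => -(φ 1 * eB R)
      | 4 => -(φ 8 * eC R)
      | 5 => φ 10 * eC R
      | 6 => -(φ 12 * eB R)
      | 11 => φ 3 * eB R + φ 10 * Sb R
      | _ => 0 := by
  fin_cases x <;> simp [Fin.sum_univ_thirteen, BN_mul_neg, bullHtpy]

variable (h q : ℤ)

lemma bullProj_isDChain : IsDChain R (CbBull R h q) (chainBull R h q) (bullProj R) := by
  constructor
  · change ∀ (x : Fin 13) (y : Fin 3), _
    intro x y
    fin_cases x <;> fin_cases y <;>
      simp [CbBull, bullLbl, bullProj, idem, eB_mul_eB, eC_mul_eC]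
  · change ∀ (x : Fin 13) (z : Fin 3),
      ∑ y : Fin 13, _ * bullδ R x y = ∑ y : Fin 3, _ * bullProj R x y
    intro x z
    rw [sum_mul_bullδ, sum_mul_bullProj]
    fin_cases x <;> fin_cases z <;>
      simp [bullProj, eC_mul_Sb, Sb_mul_eB, eC_mul_Dc, Dc_mul_eC]

lemma bullIncl_isDChain : IsDChain R (chainBull R h q) (CbBull R h q) (bullIncl R) := by
  constructor
  · change ∀ (x : Fin 3) (y : Fin 13), _
    intro x y
    fin_cases x <;> fin_cases y <;>
      simp [CbBull, bullLbl, bullIncl, idem, eB_mul_eB, eC_mul_eC, eB_mul_Sc, Sc_mul_eC,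
        eC_mul_SSc, SSc_mul_eC]
  · change ∀ (x : Fin 3) (z : Fin 13),
      ∑ y : Fin 3, _ = ∑ y : Fin 13, bullδ R y z * bullIncl R x y
    intro x z
    rw [sum_mul_bullIncl]
    fin_cases x <;> fin_cases z <;>
      simp [bullδ, bullIncl, Fin.sum_univ_three, BN_neg_mul, eC_mul_Sb, Sb_mul_eB, eC_mul_Dc,
        Dc_mul_eC, Sc_mul_Dc, SSc_mul_Dc, eB_mul_Sc, Sc_mul_eC, eC_mul_SSc, Gb_mul_Sc, Sb_mul_Sc]

lemma bullProj_isGraded : IsGraded R (CbBull R h q) (chainBull R h q) 0 (bullProj R) := by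
  constructor
  · change ∀ (x : Fin 13) (y : Fin 3), _
    intro x y
    fin_cases x <;> fin_cases y <;> simp [CbBull, bullGr, bullProj]
  · change ∀ (x : Fin 13) (y : Fin 3), _
    intro x y
    fin_cases x <;> fin_cases y <;>
      simp [CbBull, bullGr, bullProj, Homog.zero, homog_eB, homog_eC]

lemma bullIncl_isGraded : IsGraded R (chainBull R h q) (CbBull R h q) 0 (bullIncl R) := by
  constructor
  · change ∀ (x : Fin 3) (y : Fin 13), _
    intro x y
    fin_cases x <;> fin_cases y <;> simp [CbBull, bullGr, bullIncl]
  · change ∀ (x : Fin 3) (y : Fin 13), _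
    intro x y
    fin_cases x <;> fin_cases y <;>
      simp [CbBull, bullGr, bullIncl, Homog.zero, homog_eB, homog_eC, homog_Sc]
    rw [show q - 1 - (q + 1) = -2 by ring]
    exact homog_SSc

lemma bullHtpy_isHom : IsHom R (CbBull R h q) (CbBull R h q) (bullHtpy R) := by
  rintro ⟨i, hi⟩ ⟨j, hj⟩
  simp only [bullHtpy]
  split <;>
    simp [CbBull, bullLbl, idem, BN_neg_mul, BN_mul_neg, eB_mul_eB, eC_mul_eC, eC_mul_Sb, Sb_mul_eB]

lemma bullHtpy_isGraded : IsGraded R (CbBull R h q) (CbBull R h q) (-1) (bullHtpy R) := by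
  constructor <;> rintro ⟨i, hi⟩ ⟨j, hj⟩ <;> simp only [bullHtpy]
  · split <;> intro hne <;> simp [CbBull, bullGr] at hne ⊢ <;> ring
  · split <;> simp [CbBull, bullGr, Homog.zero, Homog.neg, homog_eB, homog_eC, homog_Sb]

lemma bullHtpy_htpyToId : HtpyToId R (CbBull R h q)
    (compMat R (CbBull R h q) (chainBull R h q) (CbBull R h q) (bullProj R) (bullIncl R))
    (bullHtpy R) := by
  change ∀ x z : Fin 13, (∑ y : Fin 3, _ * bullProj R x y) - _ =
    (∑ y : Fin 13, _ * bullHtpy R x y) + (∑ y : Fin 13, _ * bullδ R x y)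
  intro x z
  rw [sum_mul_bullProj, sum_mul_bullHtpy, sum_mul_bullδ]
  fin_cases x <;> fin_cases z <;>
    simp [CbBull, bullδ, bullIncl, bullHtpy, BN_neg_mul, idmat, bullLbl, idem, eB_mul_eB, eC_mul_eC, eC_mul_Sb, Sb_mul_eB,
      eC_mul_Dc, Dc_mul_eC, eB_mul_Sc, Sc_mul_eC, eB_mul_Db, Gb_mul_eB, Sb_mul_Sc, SSc_mul_eC]
  rw [Gb, SSb]
  abel

lemma bullProj_bullIncl :
    compMat R (chainBull R h q) (CbBull R h q) (chainBull R h q) (bullIncl R) (bullProj R) =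
      idmat R (chainBull R h q) := by
  change (_ : Fin 3 → Fin 3 → BN R) = _
  funext x z
  change ∑ y : Fin 13, _ * bullIncl R x y = _
  rw [sum_mul_bullIncl]
  fin_cases x <;> fin_cases z <;>
    simp [bullProj, idmat, idem, eB_mul_eB, eC_mul_eC]

theorem CbBull_hEquiv_chainBull : HEquiv R (CbBull R h q) (chainBull R h q) := by
  refine ⟨bullProj R, bullIncl R, bullHtpy R, fun _ _ => 0,
    bullProj_isDChain R h q, bullIncl_isDChain R h q,
    bullProj_isGraded R h q, bullIncl_isGraded R h q,
    bullHtpy_isHom R h q, fun _ _ => by simp,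
    bullHtpy_isGraded R h q, ⟨fun _ _ hne => absurd rfl hne, fun _ _ => Homog.zero _⟩,
    bullHtpy_htpyToId R h q, fun x z => ?_⟩
  rw [show compMat R _ _ _ _ _ = _ from bullProj_bullIncl R h q]
  simp

end Retraction

/-- For any input bigrading `(h, q)`, the bigraded type D structure `Cb_D(•)` is homotopy
equivalent to the three-generator chain `•(h−2, q−4) →S_• ∘(h−1, q−3) →D_∘ ∘(h, q−1)`. -/
theorem statement8 (R : Type*) [Field R] (h q : ℤ) :
    HEquiv R (CbBull R h q)
      { V := Fin 3
        lbl := fun i => decide (i.val = 0)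
        gr := fun i =>
          match i.val with
          | 0 => (h - 2, q - 4)
          | 1 => (h - 1, q - 3)
          | _ => (h, q - 1)
        δ := fun i j =>
          match i.val, j.val with
          | 0, 1 => Sb R
          | 1, 2 => Dc R
          | _, _ => 0 } := by
  convert CbBull_hEquiv_chainBull R h q using 2
  · funext i
    fin_cases i <;> rfl
  · funext i
    fin_cases i <;> rfl
  · funext i j
    fin_cases i <;> fin_cases j <;> rfl
end
end

section
/- For input bigrading (0,0), the bigraded type D structure Cb_D(∘) is homotopy equivalent to the direct sum of the two three-generator chains ∘(0,0) →D_∘ ∘(1,2) →S_∘ •(2,3) and •(−2,−3) →S_• ∘(−1,−2) →D_∘ ∘(0,0). -/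
noncomputable section

/-- The chain `∘(0,0) →D_∘ ∘(1,2) →S_∘ •(2,3)`. -/
def chainA (R : Type*) [CommRing R] : PreTypeD R where
  V := Fin 3
  lbl := fun i => decide (i.val = 2)
  gr := fun i =>
    match i.val with
    | 0 => (0, 0)
    | 1 => (1, 2)
    | _ => (2, 3)
  δ := fun i j =>
    match i.val, j.val with
    | 0, 1 => Dc R
    | 1, 2 => Sc R
    | _, _ => 0

/-- The chain `•(−2,−3) →S_• ∘(−1,−2) →D_∘ ∘(0,0)`. -/
def chainB (R : Type*) [CommRing R] : PreTypeD R where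
  V := Fin 3
  lbl := fun i => decide (i.val = 0)
  gr := fun i =>
    match i.val with
    | 0 => (-2, -3)
    | 1 => (-1, -2)
    | _ => (0, 0)
  δ := fun i j =>
    match i.val, j.val with
    | 0, 1 => Sb R
    | 1, 2 => Dc R
    | _, _ => 0

namespace BN

variable (R : Type*) [CommRing R]

@[simp]
theorem neg_mul_eq (a b : BN R) : -a * b = -(a * b) := neg_mul a b

@[simp]
theorem mul_neg_eq (a b : BN R) : a * -b = -(a * b) := mul_neg a b

section Relations

variable {R} in
theorem mk_eq {a b : FreeAlgebra R BNGen} (h : BNRel R a b) :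
    RingQuot.mkAlgHom R (BNRel R) a = RingQuot.mkAlgHom R (BNRel R) b :=
  RingQuot.mkAlgHom_rel R h

@[simp]
theorem eB_mul_eB : eB R * eB R = eB R := by
  simpa only [eB, BNgen, map_mul] using mk_eq (BNRel.idem_b (R := R))

@[simp]
theorem eC_mul_eC : eC R * eC R = eC R := by
  simpa only [eC, BNgen, map_mul] using mk_eq (BNRel.idem_c (R := R))

theorem eC_Sb_eB : eC R * Sb R * eB R = Sb R := by
  simpa only [eB, eC, Sb, BNgen, map_mul] using mk_eq (BNRel.typ_sb (R := R))

theorem eB_Sc_eC : eB R * Sc R * eC R = Sc R := by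
  simpa only [eB, eC, Sc, BNgen, map_mul] using mk_eq (BNRel.typ_sc (R := R))

theorem eC_Dc_eC : eC R * Dc R * eC R = Dc R := by
  simpa only [eC, Dc, BNgen, map_mul] using mk_eq (BNRel.typ_dc (R := R))

@[simp]
theorem Dc_mul_Sb : Dc R * Sb R = 0 := by
  simpa only [Sb, Dc, BNgen, map_mul, map_zero] using mk_eq (BNRel.rel_DcSb (R := R))

@[simp]
theorem Sc_mul_Dc : Sc R * Dc R = 0 := by
  simpa only [Sc, Dc, BNgen, map_mul, map_zero] using mk_eq (BNRel.rel_ScDc (R := R))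

@[simp]
theorem eC_mul_Sb : eC R * Sb R = Sb R := by
  rw [← eC_Sb_eB, ← mul_assoc, ← mul_assoc, eC_mul_eC]

@[simp]
theorem Sb_mul_eB : Sb R * eB R = Sb R := by
  rw [← eC_Sb_eB, mul_assoc, eB_mul_eB]

@[simp]
theorem eB_mul_Sc : eB R * Sc R = Sc R := by
  rw [← eB_Sc_eC, ← mul_assoc, ← mul_assoc, eB_mul_eB]

@[simp]
theorem Sc_mul_eC : Sc R * eC R = Sc R := by
  rw [← eB_Sc_eC, mul_assoc, eC_mul_eC]

@[simp]
theorem eC_mul_Dc : eC R * Dc R = Dc R := by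
  rw [← eC_Dc_eC, ← mul_assoc, ← mul_assoc, eC_mul_eC]

@[simp]
theorem Dc_mul_eC : Dc R * eC R = Dc R := by
  rw [← eC_Dc_eC, mul_assoc, eC_mul_eC]

@[simp]
theorem eC_mul_Sb_mul (x : BN R) : eC R * (Sb R * x) = Sb R * x := by
  rw [← mul_assoc, eC_mul_Sb]

@[simp]
theorem eB_mul_Sc_mul (x : BN R) : eB R * (Sc R * x) = Sc R * x := by
  rw [← mul_assoc, eB_mul_Sc]

@[simp]
theorem Dc_mul_Sb_mul (x : BN R) : Dc R * (Sb R * x) = 0 := by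
  rw [← mul_assoc, Dc_mul_Sb, zero_mul]

end Relations

section Homogeneity

variable {R}

theorem homog_zero (d : ℤ) : Homog R d 0 := Submodule.zero_mem _

theorem Homog.neg {d : ℤ} {x : BN R} (h : Homog R d x) : Homog R d (-x) :=
  Submodule.neg_mem _ h

variable (R)

theorem homog_prod (l : List BNGen) : Homog R (l.map wt).sum (l.map (BNgen R)).prod :=
  Submodule.subset_span ⟨l, rfl, rfl⟩

theorem homog_eB : Homog R 0 (eB R) := by
  simpa [wt, eB] using homog_prod R [.eb]

theorem homog_eC : Homog R 0 (eC R) := by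
  simpa [wt, eC] using homog_prod R [.ec]

theorem homog_SSb : Homog R (-2) (Sc R * Sb R) := by
  simpa [wt, Sb, Sc] using homog_prod R [.sc, .sb]

theorem homog_SSc : Homog R (-2) (Sb R * Sc R) := by
  simpa [wt, Sb, Sc] using homog_prod R [.sb, .sc]

end Homogeneity

theorem sum_mul_single {ι : Type*} [Fintype ι] [DecidableEq ι] (φ : ι → BN R) (i : ι)
    (c : BN R) : ∑ j, φ j * (Pi.single i c : ι → BN R) j = φ i * c := by
  simp [Pi.single_apply]

theorem sum_mul_add {ι : Type*} [Fintype ι] (φ r s : ι → BN R) :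
    ∑ j, φ j * (r + s) j = ∑ j, φ j * r j + ∑ j, φ j * s j := by
  simp only [Pi.add_apply, mul_add, Finset.sum_add_distrib]

theorem sum_mul_zero {ι : Type*} [Fintype ι] (φ : ι → BN R) :
    ∑ j, φ j * (0 : ι → BN R) j = 0 := by
  simp

/-- The rows of the differential of `Cb_D(∘)`. -/
def circRow : Fin 12 → Fin 12 → BN R :=
  ![Pi.single 1 (Sb R) + Pi.single 9 (Sb R),
    Pi.single 2 (Dc R) + Pi.single 3 (-eC R) + Pi.single 4 (-SSc R),
    Pi.single 5 (eC R) + Pi.single 6 (SSc R) + Pi.single 11 (-Sc R),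
    Pi.single 5 (Dc R),
    Pi.single 6 (Dc R),
    Pi.single 7 (Sc R),
    Pi.single 8 (Sc R),
    0,
    0,
    Pi.single 3 (eC R) + Pi.single 4 (Gc R) + Pi.single 10 (Dc R),
    Pi.single 5 (-eC R) + Pi.single 6 (-Gc R) + Pi.single 11 (Sc R),
    Pi.single 7 (eB R) + Pi.single 8 (SSb R)]

set_option maxHeartbeats 1000000 in
theorem circδ_eq : circδ R = circRow R := by
  funext x y
  fin_cases x <;> fin_cases y <;> simp [circδ, circRow]

/-- The direct sum of the two chains onto which `Cb_D(∘)` retracts. -/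
abbrev chains : PreTypeD R := psum R (chainA R) (chainB R)

/-- The rows of the differential of the two chains. -/
def chainsRow : Fin 3 ⊕ Fin 3 → Fin 3 ⊕ Fin 3 → BN R :=
  Sum.elim ![Pi.single (.inl 1) (Dc R), Pi.single (.inl 2) (Sc R), 0]
    ![Pi.single (.inr 1) (Sb R), Pi.single (.inr 2) (Dc R), 0]

theorem chainsδ_eq : (chains R).δ = chainsRow R := by
  funext x y
  change Fin 3 ⊕ Fin 3 at x y
  rcases x with x | x <;> rcases y with y | y <;> fin_cases x <;> fin_cases y <;>
  simp [chains, psum, chainA, chainB, chainsRow]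

/-- The projection from `Cb_D(∘)` to the two chains. -/
def proj : Fin 12 → Fin 3 ⊕ Fin 3 → BN R :=
  ![Pi.single (.inr 0) (eB R),
    0,
    0,
    Pi.single (.inl 0) (-SSc R),
    Pi.single (.inl 0) (eC R),
    Pi.single (.inl 1) (-SSc R),
    Pi.single (.inl 1) (eC R),
    Pi.single (.inl 2) (-SSb R),
    Pi.single (.inl 2) (eB R),
    Pi.single (.inr 1) (eC R),
    Pi.single (.inl 0) (eC R) + Pi.single (.inr 2) (eC R),
    0]

/-- The inclusion of the two chains into `Cb_D(∘)`. -/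
def incl : Fin 3 ⊕ Fin 3 → Fin 12 → BN R :=
  Sum.elim ![Pi.single 4 (eC R), Pi.single 6 (eC R), Pi.single 8 (eB R)]
    ![Pi.single 0 (eB R), Pi.single 1 (eC R) + Pi.single 9 (eC R),
      Pi.single 2 (eC R) + Pi.single 4 (-eC R) + Pi.single 10 (eC R)]

/-- The homotopy contracting `Cb_D(∘)` onto the two chains. -/
def contr : Fin 12 → Fin 12 → BN R :=
  ![0, 0, 0, Pi.single 1 (eC R), 0, Pi.single 2 (-eC R), 0, Pi.single 11 (-eB R), 0, 0, 0, 0]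

theorem isHom_proj : IsHom R (CbCirc R 0 0) (chains R) (proj R) := by
  intro x y
  change Fin 12 at x
  change Fin 3 ⊕ Fin 3 at y
  rcases y with y | y <;> fin_cases x <;> fin_cases y <;>
  simp [idem, CbCirc, chains, psum, chainA, chainB, circLbl, proj, SSb, SSc, mul_assoc]

theorem isHom_incl : IsHom R (chains R) (CbCirc R 0 0) (incl R) := by
  intro y x
  change Fin 12 at x
  change Fin 3 ⊕ Fin 3 at y
  rcases y with y | y <;> fin_cases x <;> fin_cases y <;>
  simp [idem, CbCirc, chains, psum, chainA, chainB, circLbl, incl]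

theorem isHom_contr : IsHom R (CbCirc R 0 0) (CbCirc R 0 0) (contr R) := by
  intro x y
  change Fin 12 at x y
  fin_cases x <;> fin_cases y <;> simp [idem, CbCirc, circLbl, contr]

theorem isDChain_proj : IsDChain R (CbCirc R 0 0) (chains R) (proj R) := by
  refine ⟨isHom_proj R, fun x z => ?_⟩
  rw [chainsδ_eq]
  change ∑ y : Fin 12, proj R y z * circδ R x y =
    ∑ y : Fin 3 ⊕ Fin 3, chainsRow R y z * proj R x y
  change Fin 12 at x
  change Fin 3 ⊕ Fin 3 at z
  rw [circδ_eq]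
  fin_cases x <;>
  simp only [circRow, proj, Fin.reduceFinMk, Matrix.cons_val, Fin.isValue,
    sum_mul_add, sum_mul_single, sum_mul_zero]
  all_goals
    rcases z with z | z <;> fin_cases z <;>
    simp [chainsRow, SSb, SSc, Gc, mul_assoc, mul_sub]
  abel

theorem isDChain_incl : IsDChain R (chains R) (CbCirc R 0 0) (incl R) := by
  refine ⟨isHom_incl R, fun x z => ?_⟩
  rw [chainsδ_eq]
  change ∑ y : Fin 3 ⊕ Fin 3, incl R y z * chainsRow R x y =
    ∑ y : Fin 12, circδ R y z * incl R x y
  change Fin 3 ⊕ Fin 3 at x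
  change Fin 12 at z
  rw [circδ_eq]
  rcases x with x | x <;> fin_cases x <;>
  simp only [chainsRow, incl, Sum.elim_inl, Sum.elim_inr, Fin.reduceFinMk, Matrix.cons_val,
    Fin.isValue, sum_mul_add, sum_mul_single, sum_mul_zero]
  all_goals
    fin_cases z <;>
    simp [circRow, SSb, SSc, Gc, mul_assoc, sub_mul]
  all_goals abel

theorem isGraded_proj : IsGraded R (CbCirc R 0 0) (chains R) 0 (proj R) := by
  constructor <;> intro x y <;> change Fin 12 at x <;> change Fin 3 ⊕ Fin 3 at y <;>
  rcases y with y | y <;> fin_cases x <;> fin_cases y <;>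
  simp [CbCirc, chains, psum, chainA, chainB, circGr, proj, SSb, SSc,
    homog_zero, Homog.neg, homog_eB, homog_eC, homog_SSb, homog_SSc]

theorem isGraded_incl : IsGraded R (chains R) (CbCirc R 0 0) 0 (incl R) := by
  constructor <;> intro y x <;> change Fin 12 at x <;> change Fin 3 ⊕ Fin 3 at y <;>
  rcases y with y | y <;> fin_cases x <;> fin_cases y <;>
  simp [CbCirc, chains, psum, chainA, chainB, circGr, incl, homog_zero,
    Homog.neg, homog_eB, homog_eC]

theorem isGraded_contr : IsGraded R (CbCirc R 0 0) (CbCirc R 0 0) (-1) (contr R) := by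
  constructor <;> intro x y <;> change Fin 12 at x y <;> fin_cases x <;> fin_cases y <;>
  simp [CbCirc, circGr, contr, homog_zero, Homog.neg, homog_eB, homog_eC]

set_option maxHeartbeats 1000000 in
theorem htpyToId_circ :
    HtpyToId R (CbCirc R 0 0)
      (compMat R (CbCirc R 0 0) (chains R) (CbCirc R 0 0) (proj R) (incl R)) (contr R) := by
  intro x z
  change (∑ y : Fin 3 ⊕ Fin 3, incl R y z * proj R x y) - idmat R (CbCirc R 0 0) x z =
    (∑ y : Fin 12, circδ R y z * contr R x y) + ∑ y : Fin 12, contr R y z * circδ R x y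
  change Fin 12 at x z
  rw [circδ_eq]
  fin_cases x <;>
  simp only [circRow, proj, contr, Fin.reduceFinMk, Matrix.cons_val, Fin.isValue,
    sum_mul_add, sum_mul_single, sum_mul_zero]
  all_goals
    fin_cases z <;>
    simp [idmat, idem, CbCirc, circLbl, incl, SSb, SSc, Gc, mul_assoc]

theorem htpyToId_chains :
    HtpyToId R (chains R)
      (compMat R (chains R) (CbCirc R 0 0) (chains R) (incl R) (proj R)) (fun _ _ => 0) := by
  intro x z
  simp only [mul_zero, zero_mul, Finset.sum_const_zero, add_zero, sub_eq_zero]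
  change ∑ y : Fin 12, proj R y z * incl R x y = idmat R (chains R) x z
  change Fin 3 ⊕ Fin 3 at x z
  rcases x with x | x <;> fin_cases x <;>
  simp only [incl, Sum.elim_inl, Sum.elim_inr, Fin.reduceFinMk, Matrix.cons_val, Fin.isValue,
    sum_mul_add, sum_mul_single]
  all_goals
    rcases z with z | z <;> fin_cases z <;>
    simp [idmat, idem, chains, psum, chainA, chainB, proj]

end BN

/-- For input bigrading `(0,0)`, the bigraded type D structure `Cb_D(∘)` is homotopy
equivalent to the direct sum of the two three-generator chains
`∘(0,0) →D_∘ ∘(1,2) →S_∘ •(2,3)` and `•(−2,−3) →S_• ∘(−1,−2) →D_∘ ∘(0,0)`. -/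
theorem statement9 (R : Type*) [Field R] :
    HEquiv R (CbCirc R 0 0) (psum R (chainA R) (chainB R)) :=
  ⟨BN.proj R, BN.incl R, BN.contr R, fun _ _ => 0,
    BN.isDChain_proj R, BN.isDChain_incl R, BN.isGraded_proj R, BN.isGraded_incl R,
    BN.isHom_contr R, fun _ _ => by simp,
    BN.isGraded_contr R, ⟨fun _ _ h => absurd rfl h, fun _ _ => BN.homog_zero _⟩,
    BN.htpyToId_circ R, BN.htpyToId_chains R⟩
end
end
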